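/- arXiv:1807.04069 — 2 statements merged into one kernel-verified Lean document; each statement's English description precedes it below -/
import Mathlib

section
/- If δ_r(u_i) = +∞, then there exists a realization (A, B, C) of the structural model in which δ(u_i) = +∞, i.e., a realization in which no perfectly undetectable attack active in u_i exists for any choice of attacked actuators U_a with u_i ∈ U_a and attacked unprotected sensors Y_a. -/
/-- Vertices of the extended graph `G_t`: actuators, states, sensors, and the sink `t`. -/
inductive Vertex (nx nu ns : ℕ) where
  | act : Fin nu → Vertex nx nu ns
  | st  : Fin nx → Vertex nx nu ns
  | sen : Fin ns → Vertex nx nu ns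
  | t   : Vertex nx nu ns

/-- Edges of the extended graph `G_t` of the structural model `([A], [B], [C])`:
`u_j → x_p` iff `[B] p j`, `x_q → x_p` iff `[A] p q`, `x_p → y_l` iff `[C] l p`,
and `y_l → t` for every sensor `y_l`. -/
def edgeRel {nx nu ns : ℕ} (Ab : Fin nx → Fin nx → Bool) (Bb : Fin nx → Fin nu → Bool)
    (Cb : Fin ns → Fin nx → Bool) : Vertex nx nu ns → Vertex nx nu ns → Prop
  | Vertex.act j, Vertex.st p => Bb p j = true
  | Vertex.st q, Vertex.st p => Ab p q = true
  | Vertex.st p, Vertex.sen l => Cb l p = true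
  | Vertex.sen _, Vertex.t => True
  | _, _ => False

/-- `S` is a vertex separator of `a` and `b` (with respect to the edge relation `E`):
`S` avoids `a` and `b`, and every directed path from `a` to `b` contains a vertex of `S`.
A directed path from `a` to `b` is encoded by a list `l` with `List.Chain E a l` and
last element `b`. -/
def IsVertexSeparator {V : Type*} (E : V → V → Prop) (a b : V) (S : Set V) : Prop :=
  a ∉ S ∧ b ∉ S ∧
    ∀ l : List V, List.Chain E a l → l.getLast? = some b → ∃ v ∈ l, v ∈ S

/-- Standing structural assumptions: each column of `[B]` is a standard basis vector,
distinct columns of `[B]` are distinct, and each row of `[C]` is a standard basis vector. -/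
def StructAssumption {nx nu ns : ℕ} (Bb : Fin nx → Fin nu → Bool)
    (Cb : Fin ns → Fin nx → Bool) : Prop :=
  (∀ j, ∃! p, Bb p j = true) ∧
    (∀ j j' : Fin nu, (∀ p, Bb p j = Bb p j') → j = j') ∧
    (∀ l, ∃! p, Cb l p = true)

/-- A realization `(A, B, C)` of the structural model `([A], [B], [C])`. -/
structure Realization {nx nu ns : ℕ} (Ab : Fin nx → Fin nx → Bool)
    (Bb : Fin nx → Fin nu → Bool) (Cb : Fin ns → Fin nx → Bool) where
  A : Matrix (Fin nx) (Fin nx) ℝ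
  B : Matrix (Fin nx) (Fin nu) ℝ
  C : Matrix (Fin ns) (Fin nx) ℝ
  hA : ∀ p q, Ab p q = false → A p q = 0
  hB0 : ∀ p j, Bb p j = false → B p j = 0
  hB1 : ∀ p j, Bb p j = true → B p j ≠ 0
  hC : ∀ l p, Cb l p = false → C l p = 0

/-- A perfectly undetectable attack on the realization `R`, using attacked actuators `Ua`
and attacked sensors `Ya`, and actively using actuator `i`: starting from `x 0 = 0` (and
zero control input), the attack signals drive the dynamics while all measurements remain
identically zero, and the attack signal on actuator `i` is not identically zero. -/
def PUAttack {nx nu ns : ℕ} {Ab : Fin nx → Fin nx → Bool} {Bb : Fin nx → Fin nu → Bool}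
    {Cb : Fin ns → Fin nx → Bool} (R : Realization Ab Bb Cb)
    (Ua : Finset (Fin nu)) (Ya : Finset (Fin ns)) (i : Fin nu) : Prop :=
  ∃ (au : ℕ → Fin nu → ℝ) (ay : ℕ → Fin ns → ℝ) (x : ℕ → Fin nx → ℝ),
    x 0 = 0 ∧
    (∀ k, x (k + 1) = R.A.mulVec (x k) + R.B.mulVec (au k)) ∧
    (∀ k, R.C.mulVec (x k) + ay k = 0) ∧
    (∀ k, ∀ j ∉ Ua, au k j = 0) ∧
    (∀ k, ∀ l ∉ Ya, ay k l = 0) ∧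
    (∃ k, au k i ≠ 0)

/-- The candidate separator associated with attacked components `(Ua, Ya)` and actuator `i`:
the states `X_a` directly driven by an attacked actuator other than `u_i`, together with
the attacked sensors `Y_a`. -/
def sepSet {nx nu ns : ℕ} (Bb : Fin nx → Fin nu → Bool)
    (Ua : Finset (Fin nu)) (Ya : Finset (Fin ns)) (i : Fin nu) :
    Set (Vertex nx nu ns) :=
  {v | (∃ p : Fin nx, v = Vertex.st p ∧ ∃ k ∈ Ua, k ≠ i ∧ Bb p k = true) ∨
    (∃ l ∈ Ya, v = Vertex.sen l)}

/-- The security index `δ(u_i)` of actuator `i` in the realization `R` with protected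
sensors `P`: the minimum of `|Ua| + |Ya|` over pairs of attacked actuators and attacked
unprotected sensors admitting a perfectly undetectable attack active in `i`. -/
noncomputable def deltaIdx {nx nu ns : ℕ} {Ab : Fin nx → Fin nx → Bool}
    {Bb : Fin nx → Fin nu → Bool} {Cb : Fin ns → Fin nx → Bool}
    (R : Realization Ab Bb Cb) (P : Set (Fin ns)) (i : Fin nu) : ℕ∞ :=
  sInf {n : ℕ∞ | ∃ (Ua : Finset (Fin nu)) (Ya : Finset (Fin ns)),
    i ∈ Ua ∧ (∀ l ∈ Ya, l ∉ P) ∧ PUAttack R Ua Ya i ∧ n = Ua.card + Ya.card}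

/-- The robust security index `δ_r(u_i)`: the minimum of `|Ua| + |Ya|` over pairs
`(Ua, Ya)` with `i ∈ Ua` and `Ya` unprotected such that `X_a ∪ Y_a` is a vertex separator
of `u_i` and `t` in the extended graph. -/
noncomputable def deltaR {nx nu ns : ℕ} (Ab : Fin nx → Fin nx → Bool)
    (Bb : Fin nx → Fin nu → Bool) (Cb : Fin ns → Fin nx → Bool)
    (P : Set (Fin ns)) (i : Fin nu) : ℕ∞ :=
  sInf {n : ℕ∞ | ∃ (Ua : Finset (Fin nu)) (Ya : Finset (Fin ns)),
    i ∈ Ua ∧ (∀ l ∈ Ya, l ∉ P) ∧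
    IsVertexSeparator (edgeRel Ab Bb Cb) (Vertex.act i) Vertex.t (sepSet Bb Ua Ya i) ∧
    n = Ua.card + Ya.card}

/-- `StepsFrom r a n b`: the vertex `b` is the end of an `r`-walk of length `n` from `a`. -/
def StepsFrom {V : Type*} (r : V → V → Prop) (a : V) : ℕ → V → Prop
  | 0, b => b = a
  | n + 1, b => ∃ c, StepsFrom r a n c ∧ r c b

theorem exists_stepsFrom_of_reflTransGen {V : Type*} {r : V → V → Prop} {a b : V}
    (h : Relation.ReflTransGen r a b) : ∃ n, StepsFrom r a n b := by
  induction h with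
  | refl => exact ⟨0, rfl⟩
  | tail _ hr ih =>
    obtain ⟨n, hn⟩ := ih
    exact ⟨n + 1, _, hn, hr⟩

theorem StepsFrom.reflTransGen {V : Type*} {r : V → V → Prop} {a : V} {n : ℕ} :
    ∀ {b : V}, StepsFrom r a n b → Relation.ReflTransGen r a b := by
  induction n with
  | zero => rintro b rfl; exact .refl
  | succ n ih => rintro b ⟨c, hc, hr⟩; exact (ih hc).tail hr

/-- Breadth-first search tree: every vertex reachable from the root `a`, other than `a`, has
a parent that is a reachable predecessor strictly closer to `a`. -/
theorem exists_parent_of_reflTransGen {V : Type*} (r : V → V → Prop) (a : V) :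
    ∃ (par : V → V) (d : V → ℕ), ∀ b, Relation.ReflTransGen r a b → b ≠ a →
      r (par b) b ∧ Relation.ReflTransGen r a (par b) ∧ d (par b) < d b := by
  classical
  let d : V → ℕ := fun b => sInf {n | StepsFrom r a n b}
  have key : ∀ b, ∃ c, Relation.ReflTransGen r a b → b ≠ a →
      r c b ∧ Relation.ReflTransGen r a c ∧ d c < d b := by
    intro b
    by_cases hb : Relation.ReflTransGen r a b ∧ b ≠ a
    · have hmem : StepsFrom r a (d b) b := Nat.sInf_mem (exists_stepsFrom_of_reflTransGen hb.1)
      cases hn : d b with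
      | zero => rw [hn] at hmem; exact absurd hmem hb.2
      | succ n =>
        rw [hn] at hmem
        obtain ⟨c, hc, hr⟩ := hmem
        exact ⟨c, fun _ _ => ⟨hr, hc.reflTransGen, Nat.lt_succ_of_le (Nat.sInf_le hc)⟩⟩
    · exact ⟨b, fun h₁ h₂ => absurd ⟨h₁, h₂⟩ hb⟩
  choose par hpar using key
  exact ⟨par, d, hpar⟩

/-- A path in the extended graph from a state to the sink passes through states only, until it
enters a sensor measuring the last of these states. -/
theorem exists_sensor_of_isChain {nx nu ns : ℕ} {Ab : Fin nx → Fin nx → Bool}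
    {Bb : Fin nx → Fin nu → Bool} {Cb : Fin ns → Fin nx → Bool} {S : Set (Vertex nx nu ns)}
    (l : List (Vertex nx nu ns)) :
    ∀ p : Fin nx, List.IsChain (edgeRel Ab Bb Cb) (Vertex.st p :: l) →
      l.getLast? = some Vertex.t → (∀ v ∈ l, v ∉ S) →
      ∃ (q : Fin nx) (m : Fin ns),
        Relation.ReflTransGen (fun a b => Ab b a = true ∧ Vertex.st b ∉ S) p q ∧
        Cb m q = true ∧ Vertex.sen m ∉ S := by
  induction l with
  | nil => intro p _ h; simp at h
  | cons v l ih =>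
    intro p hchain hlast hS
    rw [List.isChain_cons_cons] at hchain
    obtain ⟨hE, hchain⟩ := hchain
    have hv : v ∉ S := hS v (by simp)
    cases v with
    | act j => exact hE.elim
    | t => exact hE.elim
    | sen m => exact ⟨p, m, .refl, hE, hv⟩
    | st b =>
      have hl : l.getLast? = some Vertex.t := by
        cases l with
        | nil => simp at hlast
        | cons w l => simpa using hlast
      obtain ⟨q, m, hq, hm⟩ := ih b hchain hl fun w hw => hS w (by simp [hw])
      exact ⟨q, m, .head ⟨hE, hv⟩ hq, hm⟩

/-- If `δ_r(u_i) = +∞`, the state driven by `u_i` is connected to a state measured by a protected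
sensor through states that are not driven by any other actuator. -/
theorem exists_protected_path_of_deltaR_eq_top {nx nu ns : ℕ} {Ab : Fin nx → Fin nx → Bool}
    {Bb : Fin nx → Fin nu → Bool} {Cb : Fin ns → Fin nx → Bool} {P : Set (Fin ns)} {i : Fin nu}
    (htop : deltaR Ab Bb Cb P i = ⊤) :
    ∃ (p q : Fin nx) (m : Fin ns), Bb p i = true ∧ (∀ k, k ≠ i → Bb p k = false) ∧
      Relation.ReflTransGen
        (fun a b => Ab b a = true ∧ ∀ k, k ≠ i → Bb b k = false) p q ∧
      Cb m q = true ∧ m ∈ P := by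
  classical
  let Ya : Finset (Fin ns) := Finset.univ.filter (· ∉ P)
  let S := sepSet Bb Finset.univ Ya i
  have hnsep : ¬ IsVertexSeparator (edgeRel Ab Bb Cb) (Vertex.act i) Vertex.t S := by
    intro hsep
    have := sInf_eq_top.mp htop _ ⟨Finset.univ, Ya, Finset.mem_univ i, by simp [Ya], hsep, rfl⟩
    exact ENat.natCast_ne_top (Finset.card (Finset.univ : Finset (Fin nu)) + Ya.card)
      (by exact_mod_cast this)
  have hst : ∀ p, Vertex.st p ∉ S → ∀ k, k ≠ i → Bb p k = false := by
    intro p hp k hk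
    by_contra hB
    exact hp (Or.inl ⟨p, rfl, k, Finset.mem_univ k, hk, by simpa using hB⟩)
  have hsen : ∀ m, Vertex.sen m ∉ S → m ∈ P := by
    intro m hm
    by_contra hP
    exact hm (Or.inr ⟨m, by simp [Ya, hP], rfl⟩)
  have hpath : ∃ l : List (Vertex nx nu ns), List.IsChain (edgeRel Ab Bb Cb) (Vertex.act i :: l) ∧
      l.getLast? = some Vertex.t ∧ ∀ v ∈ l, v ∉ S := by
    by_contra! hno
    exact hnsep ⟨by simp [S, sepSet], by simp [S, sepSet], hno⟩
  obtain ⟨l, hchain, hlast, hS⟩ := hpath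
  cases l with
  | nil => simp at hlast
  | cons v l =>
    rw [List.isChain_cons_cons] at hchain
    obtain ⟨hE, hchain⟩ := hchain
    cases v with
    | act j => exact hE.elim
    | t => exact hE.elim
    | sen m => exact hE.elim
    | st p =>
      have hl : l.getLast? = some Vertex.t := by
        cases l with
        | nil => simp at hlast
        | cons w l => simpa using hlast
      obtain ⟨q, m, hq, hC, hm⟩ :=
        exists_sensor_of_isChain l p hchain hl fun w hw => hS w (by simp [hw])
      exact ⟨p, q, m, hE, hst p (hS _ (by simp)),
        Relation.ReflTransGen.mono (fun a b h => ⟨h.1, hst b h.2⟩) _ _ hq, hC, hsen m hm⟩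

/-- Corollary 1: if `δ_r(u_i) = +∞`, then there exists a realization of the structural
model in which `δ(u_i) = +∞`, i.e. no perfectly undetectable attack active in `u_i`
exists for any choice of attacked actuators and attacked unprotected sensors. -/
theorem deltaR_top_implies_exists_realization_delta_top {nx nu ns : ℕ}
    (Ab : Fin nx → Fin nx → Bool) (Bb : Fin nx → Fin nu → Bool)
    (Cb : Fin ns → Fin nx → Bool) (P : Set (Fin ns))
    (hstruct : StructAssumption Bb Cb) (i : Fin nu)
    (htop : deltaR Ab Bb Cb P i = ⊤) :
    ∃ R : Realization Ab Bb Cb, deltaIdx R P i = ⊤ := by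
  classical
  obtain ⟨hBcol, -, hCrow⟩ := hstruct
  obtain ⟨p₀, q₀, m, hB₀, hB₀', hreach, hCm, hmP⟩ := exists_protected_path_of_deltaR_eq_top htop
  let r : Fin nx → Fin nx → Prop := fun a b => Ab b a = true ∧ ∀ k, k ≠ i → Bb b k = false
  obtain ⟨par, d, hpar⟩ := exists_parent_of_reflTransGen r p₀
  let R : Realization Ab Bb Cb :=
    { A := fun p q =>
        if (Relation.ReflTransGen r p₀ p ∧ p ≠ p₀) ∧ q = par p then 1 else 0
      B := fun p j => if Bb p j = true then 1 else 0
      C := fun l p => if Cb l p = true then 1 else 0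
      hA := by
        intro p q h
        refine if_neg ?_
        rintro ⟨⟨hp, hne⟩, rfl⟩
        simp [(hpar p hp hne).1.1] at h
      hB0 := by intro p j h; simp [h]
      hB1 := by intro p j h; simp [h]
      hC := by intro l p h; simp [h] }
  refine ⟨R, sInf_eq_top.mpr ?_⟩
  rintro n ⟨Ua, Ya, -, hYa, ⟨au, ay, x, -, hx, hy, -, hay, k, hk⟩, -⟩
  exfalso
  have hzero : ∀ n p, d p = n → Relation.ReflTransGen r p₀ p → (∀ k, x k p = 0) →
      ∀ k, x k p₀ = 0 := by
    intro n
    induction n using Nat.strong_induction_on with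
    | _ n ih =>
      intro p hd hp hxp
      by_cases hne : p = p₀
      · exact hne ▸ hxp
      obtain ⟨hr, hpp, hlt⟩ := hpar p hp hne
      refine ih _ (hd ▸ hlt) (par p) rfl hpp fun k => ?_
      have hBp : ∀ j, Bb p j = false := by
        intro j
        by_cases hj : j = i
        · subst hj
          by_contra hB
          exact hne ((hBcol j).unique (by simpa using hB) hB₀)
        · exact hr.2 j hj
      have hxk := congrFun (hx k) p
      simpa [R, Matrix.mulVec, dotProduct, hxp, hp, hne, hBp] using hxk.symm
  have hxq : ∀ k, x k q₀ = 0 := by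
    intro k
    have hyk := congrFun (hy k) m
    have hCiff : ∀ q, Cb m q = true ↔ q = q₀ := fun q =>
      ⟨fun h => (hCrow m).unique h hCm, fun h => h ▸ hCm⟩
    simpa [R, Matrix.mulVec, dotProduct, hCiff,
      hay k m fun hm => hYa m hm hmP] using hyk
  have hx₀ := hzero _ q₀ rfl hreach hxq
  have hBiff : ∀ j, Bb p₀ j = true ↔ j = i := fun j =>
    ⟨fun h => by_contra fun hj => by simp [hB₀' j hj] at h, fun h => h ▸ hB₀⟩
  have hxk := congrFun (hx k) p₀
  apply hk
  simpa [R, Matrix.mulVec, dotProduct, hx₀, hBiff] using hxk.symm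
end

section
/- Assume that every state directly influenced by some actuator is measured by some sensor (for all states x_j and actuators u_k with [B] j k = true there exists a sensor y_p with [C] p j = true), and let u_i be an actuator with δ_r(u_i) ≠ +∞. Then placing one new sensor measuring a state x_m strictly increases the robust security index δ_r(u_i) if and only if x_m ∈ X_{u_i}. -/
/-- Extend the structural output matrix `[C]` with one new sensor row measuring state
`xm` (the new row is the standard basis vector `e_{xm}`). -/
def extendC {nx ns : ℕ} (Cb : Fin ns → Fin nx → Bool) (xm : Fin nx) :
    Fin (ns + 1) → Fin nx → Bool :=
  fun l p => if h : (l : ℕ) < ns then Cb ⟨l, h⟩ p else decide (p = xm)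

/-- The original protected sensors, viewed inside the extended sensor index set. -/
def liftP {ns : ℕ} (P : Set (Fin ns)) : Set (Fin (ns + 1)) :=
  {l | ∃ l0 ∈ P, l = Fin.castSucc l0}

/-- The set `X_{u_i}` of states `x_k` reachable from `u_i` by a directed path
`u_i, x_{j_1}, …, x_k` in the extended graph on which no state is adjacent to an actuator
other than `u_i`. -/
def XSet {nx nu : ℕ} (Ab : Fin nx → Fin nx → Bool) (Bb : Fin nx → Fin nu → Bool)
    (i : Fin nu) : Set (Fin nx) :=
  {xk | ∃ l : List (Fin nx),
    l.getLast? = some xk ∧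
    (∃ h, l.head? = some h ∧ Bb h i = true) ∧
    List.Chain' (fun q p => Ab p q) l ∧
    (∀ p ∈ l, ∀ j : Fin nu, j ≠ i → Bb p j = false)}

section RobustSecurityIndex

variable {nx nu ns : ℕ} {Ab : Fin nx → Fin nx → Bool} {Bb : Fin nx → Fin nu → Bool}
  {Cb : Fin ns → Fin nx → Bool} {P : Set (Fin ns)} {i : Fin nu}

/-- States of `XSet` are not driven by actuators other than `i`. -/
lemma XSet_not_driven {p : Fin nx} (hp : p ∈ XSet Ab Bb i) {j : Fin nu} (hj : j ≠ i) :
    Bb p j = false := by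
  obtain ⟨l, hlast, -, -, hl⟩ := hp
  exact hl p (List.mem_of_getLast? hlast) j hj

lemma XSet_of_driven {p : Fin nx} (hp : Bb p i = true)
    (hclean : ∀ j : Fin nu, j ≠ i → Bb p j = false) : p ∈ XSet Ab Bb i :=
  ⟨[p], rfl, ⟨p, rfl, hp⟩, List.isChain_singleton _, by simpa using hclean⟩

lemma XSet_step {p q : Fin nx} (hp : p ∈ XSet Ab Bb i) (hpq : Ab q p = true)
    (hclean : ∀ j : Fin nu, j ≠ i → Bb q j = false) : q ∈ XSet Ab Bb i := by
  obtain ⟨l, hlast, ⟨h, hh, hhi⟩, hchain, hl⟩ := hp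
  refine ⟨l ++ [q], by simp, ⟨h, by simp [hh], hhi⟩, ?_, ?_⟩
  · refine List.isChain_append.2 ⟨hchain, List.isChain_singleton _, ?_⟩
    simp [hlast, hpq]
  · intro r hr
    rcases List.mem_append.1 hr with hr | hr
    · exact hl r hr
    · rw [List.mem_singleton.1 hr]
      exact hclean

lemma mem_sepSet_st {Ua : Finset (Fin nu)} {Ya : Finset (Fin ns)} {p : Fin nx} :
    Vertex.st p ∈ sepSet Bb Ua Ya i ↔ ∃ k ∈ Ua, k ≠ i ∧ Bb p k = true := by
  simp [sepSet]

lemma mem_sepSet_sen {Ua : Finset (Fin nu)} {Ya : Finset (Fin ns)} {l : Fin ns} :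
    Vertex.sen l ∈ sepSet Bb Ua Ya i ↔ l ∈ Ya := by
  simp [sepSet]

lemma act_notMem_sepSet {Ua : Finset (Fin nu)} {Ya : Finset (Fin ns)} {j : Fin nu} :
    Vertex.act j ∉ sepSet Bb Ua Ya i := by
  simp [sepSet]

lemma t_notMem_sepSet {Ua : Finset (Fin nu)} {Ya : Finset (Fin ns)} :
    Vertex.t ∉ sepSet Bb Ua Ya i := by
  simp [sepSet]

/-- A path from a state of `XSet` to the sink must meet the separator after that state. -/
lemma exists_mem_sepSet_of_chain {Ua : Finset (Fin nu)} {Ya : Finset (Fin ns)}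
    (hsep : IsVertexSeparator (edgeRel Ab Bb Cb) (Vertex.act i) Vertex.t (sepSet Bb Ua Ya i))
    {p : Fin nx} (hp : p ∈ XSet Ab Bb i) {l : List (Vertex nx nu ns)}
    (hl : List.IsChain (edgeRel Ab Bb Cb) (Vertex.st p :: l))
    (hlast : l.getLast? = some Vertex.t) : ∃ v ∈ l, v ∈ sepSet Bb Ua Ya i := by
  obtain ⟨m, hmlast, ⟨h, hh, hhi⟩, hchain, hm⟩ := hp
  have hchain' : List.IsChain (edgeRel Ab Bb Cb) (Vertex.act i :: (m.map Vertex.st ++ l)) := by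
    refine List.isChain_cons.2 ⟨by simp [hh, edgeRel, hhi], List.isChain_append.2 ⟨?_, ?_, ?_⟩⟩
    · rw [List.isChain_map]
      exact hchain
    · exact (List.isChain_cons.1 hl).2
    · have := (List.isChain_cons.1 hl).1
      simpa [hmlast] using this
  obtain ⟨v, hv, hvS⟩ := hsep.2.2 _ hchain' (by simp [hlast])
  rcases List.mem_append.1 hv with hv | hv
  · obtain ⟨q, hq, rfl⟩ := List.mem_map.1 hv
    obtain ⟨k, -, hki, hk⟩ := mem_sepSet_st.1 hvS
    simp [hm q hq k hki] at hk
  · exact ⟨v, hv, hvS⟩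

open Classical in
/-- Sensors measuring a state of `XSet`. -/
noncomputable def exposedSensors (Ab : Fin nx → Fin nx → Bool) (Bb : Fin nx → Fin nu → Bool)
    (Cb : Fin ns → Fin nx → Bool) (i : Fin nu) : Finset (Fin ns) :=
  {l | ∃ p ∈ XSet Ab Bb i, Cb l p = true}

open Classical in
/-- Actuators other than `i` driving a successor of a state of `XSet`. -/
noncomputable def boundaryActuators (Ab : Fin nx → Fin nx → Bool) (Bb : Fin nx → Fin nu → Bool)
    (i : Fin nu) : Finset (Fin nu) :=
  {k | k ≠ i ∧ ∃ q, Bb q k = true ∧ ∃ p ∈ XSet Ab Bb i, Ab q p = true}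

lemma mem_exposedSensors {l : Fin ns} :
    l ∈ exposedSensors Ab Bb Cb i ↔ ∃ p ∈ XSet Ab Bb i, Cb l p = true := by
  simp [exposedSensors]

lemma mem_boundaryActuators {k : Fin nu} :
    k ∈ boundaryActuators Ab Bb i ↔
      k ≠ i ∧ ∃ q, Bb q k = true ∧ ∃ p ∈ XSet Ab Bb i, Ab q p = true := by
  simp [boundaryActuators]

lemma exposedSensors_subset_of_separator {Ua : Finset (Fin nu)} {Ya : Finset (Fin ns)}
    (hsep : IsVertexSeparator (edgeRel Ab Bb Cb) (Vertex.act i) Vertex.t (sepSet Bb Ua Ya i)) :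
    exposedSensors Ab Bb Cb i ⊆ Ya := by
  intro l hl
  obtain ⟨p, hp, hlp⟩ := mem_exposedSensors.1 hl
  obtain ⟨v, hv, hvS⟩ := exists_mem_sepSet_of_chain hsep hp
    (l := [Vertex.sen l, Vertex.t]) (by simp [edgeRel, hlp]) rfl
  rcases List.mem_cons.1 hv with rfl | hv
  · exact mem_sepSet_sen.1 hvS
  · rw [List.mem_singleton.1 hv] at hvS
    exact absurd hvS t_notMem_sepSet

/-- The columns of `[B]` being distinct basis vectors, no state is driven by two actuators. -/
lemma StructAssumption.driver_unique (h : StructAssumption Bb Cb) {p : Fin nx} {j k : Fin nu}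
    (hj : Bb p j = true) (hk : Bb p k = true) : j = k := by
  refine h.2.1 j k fun q => ?_
  have hjq : Bb q j = true ↔ q = p := ⟨fun hq => (h.1 j).unique hq hj, fun e => e ▸ hj⟩
  have hkq : Bb q k = true ↔ q = p := ⟨fun hq => (h.1 k).unique hq hk, fun e => e ▸ hk⟩
  rw [Bool.eq_iff_iff, hjq, hkq]

lemma boundary_attacked_of_separator (hstruct : StructAssumption Bb Cb)
    {Ua : Finset (Fin nu)} {Ya : Finset (Fin ns)}
    (hsep : IsVertexSeparator (edgeRel Ab Bb Cb) (Vertex.act i) Vertex.t (sepSet Bb Ua Ya i))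
    {k : Fin nu} (hk : k ∈ boundaryActuators Ab Bb i) (hkU : k ∉ Ua)
    {q : Fin nx} (hqk : Bb q k = true) {l : Fin ns} (hl : Cb l q = true) : l ∈ Ya := by
  obtain ⟨hki, q', hq', p, hp, hpq⟩ := mem_boundaryActuators.1 hk
  obtain rfl := (hstruct.1 k).unique hqk hq'
  obtain ⟨v, hv, hvS⟩ := exists_mem_sepSet_of_chain hsep hp
    (l := [Vertex.st q, Vertex.sen l, Vertex.t]) (by simp [edgeRel, hl, hpq]) rfl
  rcases List.mem_cons.1 hv with rfl | hv
  · obtain ⟨j, hjU, -, hj⟩ := mem_sepSet_st.1 hvS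
    exact absurd (hstruct.driver_unique hqk hj ▸ hjU) hkU
  rcases List.mem_cons.1 hv with rfl | hv
  · exact mem_sepSet_sen.1 hvS
  · rw [List.mem_singleton.1 hv] at hvS
    exact absurd hvS t_notMem_sepSet

lemma card_le_of_separator (hstruct : StructAssumption Bb Cb)
    (hcov : ∀ (j : Fin nx) (k : Fin nu), Bb j k = true → ∃ p : Fin ns, Cb p j = true)
    {Ua : Finset (Fin nu)} {Ya : Finset (Fin ns)} (hi : i ∈ Ua)
    (hsep : IsVertexSeparator (edgeRel Ab Bb Cb) (Vertex.act i) Vertex.t (sepSet Bb Ua Ya i)) :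
    1 + (boundaryActuators Ab Bb i).card + (exposedSensors Ab Bb Cb i).card ≤
      Ua.card + Ya.card := by
  classical
  have hsensor : ∀ k : Fin nu, ∃ l : Fin ns, ∃ q, Bb q k = true ∧ Cb l q = true := fun k => by
    obtain ⟨q, hq, -⟩ := hstruct.1 k
    obtain ⟨l, hl⟩ := hcov q k hq
    exact ⟨l, q, hq, hl⟩
  choose s q hq hs using hsensor
  have s_inj : Function.Injective s := fun k k' h => by
    have hqq : q k = q k' := (hstruct.2.2 (s k)).unique (hs k) (h ▸ hs k')
    exact hstruct.driver_unique (hq k) (hqq ▸ hq k')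
  set K := boundaryActuators Ab Bb i
  have hK1 : K ∩ Ua ⊆ Ua.erase i := fun k hk => by
    obtain ⟨hkK, hkU⟩ := Finset.mem_inter.1 hk
    exact Finset.mem_erase.2 ⟨(mem_boundaryActuators.1 hkK).1, hkU⟩
  have hK2 : (K \ Ua).image s ⊆ Ya := fun l hl => by
    obtain ⟨k, hk, rfl⟩ := Finset.mem_image.1 hl
    obtain ⟨hkK, hkU⟩ := Finset.mem_sdiff.1 hk
    exact boundary_attacked_of_separator hstruct hsep hkK hkU (hq k) (hs k)
  have hdisj : Disjoint ((K \ Ua).image s) (exposedSensors Ab Bb Cb i) := by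
    refine Finset.disjoint_left.2 fun l hl hl' => ?_
    obtain ⟨k, hk, rfl⟩ := Finset.mem_image.1 hl
    obtain ⟨p, hp, hlp⟩ := mem_exposedSensors.1 hl'
    have hki := (mem_boundaryActuators.1 (Finset.mem_sdiff.1 hk).1).1
    have hpk := XSet_not_driven hp hki
    rw [(hstruct.2.2 (s k)).unique hlp (hs k), hq k] at hpk
    exact Bool.noConfusion hpk
  have h1 := Finset.card_le_card hK1
  have h2 := Finset.card_le_card
    (Finset.union_subset hK2 (exposedSensors_subset_of_separator hsep))
  rw [Finset.card_union_of_disjoint hdisj, Finset.card_image_of_injective _ s_inj] at h2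
  have h3 := Finset.card_inter_add_card_sdiff K Ua
  have h4 := Finset.card_erase_add_one hi
  omega

/-- The boundary actuators together with the exposed sensors cut `XSet` off from the sink. -/
lemma isVertexSeparator_boundary (hstruct : StructAssumption Bb Cb) :
    IsVertexSeparator (edgeRel Ab Bb Cb) (Vertex.act i) Vertex.t
      (sepSet Bb (insert i (boundaryActuators Ab Bb i)) (exposedSensors Ab Bb Cb i) i) := by
  set S := sepSet Bb (insert i (boundaryActuators Ab Bb i)) (exposedSensors Ab Bb Cb i) i
  have mem_of_driven : ∀ p q : Fin nx, p ∈ XSet Ab Bb i → Ab q p = true →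
      q ∉ XSet Ab Bb i → Vertex.st q ∈ S := fun p q hp hpq hq => by
    have : ∃ k, k ≠ i ∧ Bb q k = true := by
      by_contra! hcon
      exact hq (XSet_step hp hpq fun j hj => by simpa using hcon j hj)
    obtain ⟨k, hki, hk⟩ := this
    exact mem_sepSet_st.2 ⟨k, Finset.mem_insert_of_mem
      (mem_boundaryActuators.2 ⟨hki, q, hk, p, hp, hpq⟩), hki, hk⟩
  have from_state : ∀ l : List (Vertex nx nu ns), ∀ p ∈ XSet Ab Bb i,
      List.IsChain (edgeRel Ab Bb Cb) (Vertex.st p :: l) → l.getLast? = some Vertex.t →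
      ∃ v ∈ l, v ∈ S := by
    intro l
    induction l with
    | nil => simp
    | cons v l ih =>
      intro p hp hl hlast
      obtain ⟨hpv, hl⟩ := List.isChain_cons_cons.1 hl
      match v, hpv with
      | Vertex.st q, hpq =>
        by_cases hq : q ∈ XSet Ab Bb i
        · have hlast' : l.getLast? = some Vertex.t := by
            cases l with
            | nil => simp at hlast
            | cons w l => simpa using hlast
          obtain ⟨w, hw, hwS⟩ := ih q hq hl hlast'
          exact ⟨w, List.mem_cons_of_mem _ hw, hwS⟩
        · exact ⟨_, List.mem_cons_self, mem_of_driven p q hp hpq hq⟩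
      | Vertex.sen r, hpr =>
        exact ⟨_, List.mem_cons_self, mem_sepSet_sen.2 (mem_exposedSensors.2 ⟨p, hp, hpr⟩)⟩
  refine ⟨act_notMem_sepSet, t_notMem_sepSet, fun l hl hlast => ?_⟩
  cases l with
  | nil => simp at hlast
  | cons v l =>
    obtain ⟨hpv, hl⟩ := List.isChain_cons_cons.1 hl
    match v, hpv with
    | Vertex.st p, hpi =>
      have hlast' : l.getLast? = some Vertex.t := by
        cases l with
        | nil => simp at hlast
        | cons w l => simpa using hlast
      have hp : p ∈ XSet Ab Bb i := XSet_of_driven hpi fun j hj =>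
        Bool.eq_false_iff.2 fun hpj => hj (hstruct.driver_unique hpj hpi)
      obtain ⟨w, hw, hwS⟩ := from_state l p hp hl hlast'
      exact ⟨w, List.mem_cons_of_mem _ hw, hwS⟩

/-- The robust security index is infinite when some exposed sensor is protected. -/
lemma deltaR_eq_top (h : ∃ l ∈ exposedSensors Ab Bb Cb i, l ∈ P) :
    deltaR Ab Bb Cb P i = ⊤ := by
  obtain ⟨l, hl, hlP⟩ := h
  refine sInf_eq_top.2 ?_
  rintro n ⟨Ua, Ya, -, hY, hsep, -⟩
  exact absurd hlP (hY l (exposedSensors_subset_of_separator hsep hl))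

/-- Without protected exposed sensors, the robust security index counts `i`, the boundary
actuators and the exposed sensors. -/
lemma deltaR_eq_card (hstruct : StructAssumption Bb Cb)
    (hcov : ∀ (j : Fin nx) (k : Fin nu), Bb j k = true → ∃ p : Fin ns, Cb p j = true)
    (h : ∀ l ∈ exposedSensors Ab Bb Cb i, l ∉ P) :
    deltaR Ab Bb Cb P i =
      ((1 + (boundaryActuators Ab Bb i).card + (exposedSensors Ab Bb Cb i).card : ℕ) : ℕ∞) := by
  refine le_antisymm (sInf_le ⟨_, _, Finset.mem_insert_self _ _, h,
    isVertexSeparator_boundary hstruct, ?_⟩) (le_sInf ?_)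
  · rw [Finset.card_insert_of_notMem fun hi => (mem_boundaryActuators.1 hi).1 rfl]
    push_cast
    ring
  · rintro n ⟨Ua, Ya, hi, -, hsep, rfl⟩
    exact_mod_cast card_le_of_separator hstruct hcov hi hsep

@[simp]
lemma extendC_castSucc {xm p : Fin nx} {l : Fin ns} :
    extendC Cb xm l.castSucc p = Cb l p := by
  simp [extendC]

@[simp]
lemma extendC_last {xm p : Fin nx} :
    extendC Cb xm (Fin.last ns) p = decide (p = xm) := by
  simp [extendC]

lemma StructAssumption.extendC (hstruct : StructAssumption Bb Cb) (xm : Fin nx) :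
    StructAssumption Bb (extendC Cb xm) := by
  refine ⟨hstruct.1, hstruct.2.1, fun l => ?_⟩
  induction l using Fin.lastCases with
  | last => simp
  | cast l => simpa using hstruct.2.2 l

lemma castSucc_mem_exposedSensors {xm : Fin nx} {l : Fin ns} :
    l.castSucc ∈ exposedSensors Ab Bb (extendC Cb xm) i ↔ l ∈ exposedSensors Ab Bb Cb i := by
  simp [mem_exposedSensors]

lemma last_mem_exposedSensors {xm : Fin nx} :
    Fin.last ns ∈ exposedSensors Ab Bb (extendC Cb xm) i ↔ xm ∈ XSet Ab Bb i := by
  simp [mem_exposedSensors]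

open Classical in
lemma card_exposedSensors_extendC (xm : Fin nx) :
    (exposedSensors Ab Bb (extendC Cb xm) i).card =
      (exposedSensors Ab Bb Cb i).card + if xm ∈ XSet Ab Bb i then 1 else 0 := by
  rw [exposedSensors, exposedSensors, Finset.card_filter, Finset.card_filter,
    Fin.sum_univ_castSucc]
  simp

lemma castSucc_mem_liftP {l : Fin ns} : l.castSucc ∈ liftP P ↔ l ∈ P := by
  simp [liftP]

lemma last_notMem_liftP : Fin.last ns ∉ liftP P := by
  rintro ⟨l, -, hl⟩
  exact (Fin.castSucc_lt_last l).ne hl.symm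

end RobustSecurityIndex

/-- Theorem 4 (second part): assume every state directly influenced by some actuator is
measured by some sensor, and let `u_i` have finite robust security index. Then placing one
new sensor (protected or unprotected) measuring a state `xm` strictly increases the robust
security index of `u_i` if and only if `xm ∈ X_{u_i}`. -/
theorem deltaR_increases_iff_XSet {nx nu ns : ℕ}
    (Ab : Fin nx → Fin nx → Bool) (Bb : Fin nx → Fin nu → Bool)
    (Cb : Fin ns → Fin nx → Bool) (P : Set (Fin ns))
    (hstruct : StructAssumption Bb Cb)
    (hcov : ∀ (j : Fin nx) (k : Fin nu), Bb j k = true → ∃ p : Fin ns, Cb p j = true)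
    (i : Fin nu) (hfin : deltaR Ab Bb Cb P i ≠ ⊤)
    (xm : Fin nx) (prot : Bool) :
    deltaR Ab Bb Cb P i <
      deltaR Ab Bb (extendC Cb xm)
        (liftP P ∪ (if prot then {Fin.last ns} else (∅ : Set (Fin (ns + 1))))) i ↔
    xm ∈ XSet Ab Bb i := by
  classical
  have hunprot : ∀ l ∈ exposedSensors Ab Bb Cb i, l ∉ P := fun l hl hlP =>
    hfin (deltaR_eq_top ⟨l, hl, hlP⟩)
  have hcov' : ∀ (j : Fin nx) (k : Fin nu), Bb j k = true →
      ∃ p : Fin (ns + 1), extendC Cb xm p j = true := fun j k hjk => by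
    obtain ⟨p, hp⟩ := hcov j k hjk
    exact ⟨p.castSucc, by simpa using hp⟩
  by_cases htop : prot = true ∧ xm ∈ XSet Ab Bb i
  · rw [deltaR_eq_top (Cb := extendC Cb xm)
      ⟨Fin.last ns, last_mem_exposedSensors.2 htop.2, by simp [htop.1]⟩]
    exact iff_of_true hfin.lt_top htop.2
  · have hunprot' : ∀ l ∈ exposedSensors Ab Bb (extendC Cb xm) i,
        l ∉ liftP P ∪ (if prot then {Fin.last ns} else (∅ : Set (Fin (ns + 1)))) := by
      intro l
      induction l using Fin.lastCases with
      | last =>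
        intro hl
        have hprot : prot = false :=
          Bool.eq_false_iff.2 fun hp => htop ⟨hp, last_mem_exposedSensors.1 hl⟩
        simp [hprot, last_notMem_liftP]
      | cast l =>
        intro hl
        have hlP := hunprot l (castSucc_mem_exposedSensors.1 hl)
        cases prot <;> simp [castSucc_mem_liftP, hlP, (Fin.castSucc_lt_last l).ne]
    rw [deltaR_eq_card hstruct hcov hunprot,
      deltaR_eq_card (hstruct.extendC xm) hcov' hunprot', card_exposedSensors_extendC,
      Nat.cast_lt]
    split_ifs with hx <;> simp [hx]
end
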